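/- arXiv:2310.06402 — 7 statements merged into one kernel-verified Lean document; each statement's English description precedes it below -/
import Mathlib

section
/- Suppose that the mismatched strong-monotonicity constant satisfies ρ̂ = ρ + αλ_min − ζ̃_{L*−K} ≥ 0. Then the set-valued operator A + D_K (x ↦ {u + D_K x : u ∈ A x}) is maximally monotone; in particular, for all (x,u) and (y,v) in the graph of A, ⟪x − y, (u + D_K x) − (v + D_K y)⟫ ≥ ρ̂‖x − y‖² ≥ 0. -/
open Filter Topology
open scoped RealInnerProductSpace Pointwise

noncomputable section

variable {H G : Type*}

/-- A set-valued operator `A` is `ρ`-monotone. -/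
def IsMonotoneSV [NormedAddCommGroup H] [InnerProductSpace ℝ H]
    (ρ : ℝ) (A : H → Set H) : Prop :=
  ∀ x y u v, u ∈ A x → v ∈ A y → ρ * ‖x - y‖ ^ 2 ≤ ⟪x - y, u - v⟫

/-- `A` is maximally `ρ`-monotone: it is `ρ`-monotone and its graph is maximal, under
inclusion, among graphs of `ρ`-monotone operators. -/
def IsMaxMonotoneSV [NormedAddCommGroup H] [InnerProductSpace ℝ H]
    (ρ : ℝ) (A : H → Set H) : Prop :=
  IsMonotoneSV ρ A ∧
    ∀ A' : H → Set H, IsMonotoneSV ρ A' → (∀ x, A x ⊆ A' x) → ∀ x, A' x = A x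

/-- `C` is `β`-cocoercive. -/
def IsCocoercive [NormedAddCommGroup H] [InnerProductSpace ℝ H]
    (β : ℝ) (C : H → H) : Prop :=
  ∀ x y, β * ‖C x - C y‖ ^ 2 ≤ ⟪x - y, C x - C y⟫

/-- `k` is a Lipschitz bound for `f`. -/
def IsLipBound {E F : Type*} [NormedAddCommGroup E] [NormedAddCommGroup F]
    (k : ℝ) (f : E → F) : Prop :=
  ∀ x y, ‖f x - f y‖ ≤ k * ‖x - y‖

/-- `k` is the (smallest) Lipschitz constant of `f`. -/
def IsLipConst {E F : Type*} [NormedAddCommGroup E] [NormedAddCommGroup F]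
    (k : ℝ) (f : E → F) : Prop :=
  IsLipBound k f ∧ ∀ k', IsLipBound k' f → k ≤ k'

/-- A single-valued map `B` is monotone. -/
def IsMonotoneMap [NormedAddCommGroup G] [InnerProductSpace ℝ G]
    (B : G → G) : Prop :=
  ∀ x y, (0:ℝ) ≤ ⟪x - y, B x - B y⟫

/-- The operator `D_M : x ↦ α M (L x - c) + M (B (L x))`. -/
def Dop [NormedAddCommGroup H] [InnerProductSpace ℝ H]
    [NormedAddCommGroup G] [InnerProductSpace ℝ G]
    (α : ℝ) (L : H →L[ℝ] G) (c : G) (B : G → G) (M : G →L[ℝ] H) : H → H :=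
  fun x => α • M (L x - c) + M (B (L x))

/-- `λ_min = inf {⟪x, K (L x)⟫ : ‖x‖ = 1}`. -/
def lambdaMin [NormedAddCommGroup H] [InnerProductSpace ℝ H]
    [NormedAddCommGroup G] [InnerProductSpace ℝ G]
    (L : H →L[ℝ] G) (K : G →L[ℝ] H) : ℝ :=
  sInf {r : ℝ | ∃ x : H, ‖x‖ = 1 ∧ r = ⟪x, K (L x)⟫}

/-- The step-size bound `χ`. -/
def chiConst (β ρ κ : ℝ) : ℝ :=
  if 0 ≤ ρ then 4 * β / (1 + Real.sqrt (1 + 16 * β ^ 2 * κ ^ 2))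
  else min (4 * β / (1 + Real.sqrt (1 + 16 * β ^ 2 * κ ^ 2))) (-1 / ρ)


theorem nonneg_of_forall_mul_add_sq_mul_nonneg {a b : ℝ} (hb : 0 ≤ b)
    (h : ∀ s : ℝ, 0 < s → s ≤ 1 → 0 ≤ s * a + s ^ 2 * b) : 0 ≤ a := by
  by_contra! ha
  have hba : 0 < b - a := by linarith
  have hs : 0 < -a / (b - a) := div_pos (by linarith) hba
  have h1 := h (-a / (b - a)) hs ((div_le_one hba).2 (by linarith))
  have h2 : -a / (b - a) * a + (-a / (b - a)) ^ 2 * b = -a / (b - a) * (-(a ^ 2) / (b - a)) := by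
    field_simp
    ring
  rw [h2] at h1
  have h3 : -(a ^ 2) / (b - a) < 0 := div_neg_of_neg_of_pos (by nlinarith) hba
  nlinarith [mul_pos_of_neg_of_neg h3 (neg_neg_of_pos hs)]

/-- The functional `(p, t) ↦ t + ‖p‖² / 2` attains its minimum over a nonempty closed convex set
on which it is bounded below; the minimizer is described by a variational inequality. -/
theorem exists_variational_inequality {E : Type*} [NormedAddCommGroup E] [InnerProductSpace ℝ E]
    [CompleteSpace E] {S : Set (E × ℝ)} (hne : S.Nonempty) (hcl : IsClosed S) (hconv : Convex ℝ S)
    (hbdd : ∀ q ∈ S, 0 ≤ q.2 + ‖q.1‖ ^ 2 / 2) :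
    ∃ q₀ ∈ S, ∀ q ∈ S, q₀.2 + ‖q₀.1‖ ^ 2 ≤ q.2 + ⟪q₀.1, q.1⟫ := by
  set φ : E × ℝ → ℝ := fun q => q.2 + ‖q.1‖ ^ 2 / 2 with hφ
  have hbelow : BddBelow (φ '' S) := ⟨0, by rintro _ ⟨q, hq, rfl⟩; exact hbdd q hq⟩
  set m := sInf (φ '' S) with hm
  have hmle : ∀ q ∈ S, m ≤ φ q := fun q hq => csInf_le hbelow ⟨q, hq, rfl⟩
  have hex : ∀ n : ℕ, ∃ q ∈ S, φ q < m + 1 / ((n : ℝ) + 1) := by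
    intro n
    obtain ⟨_, ⟨q, hq, rfl⟩, hlt⟩ := exists_lt_of_csInf_lt (hne.image φ)
      (show sInf (φ '' S) < m + 1 / ((n : ℝ) + 1) from lt_add_of_pos_right _ (by positivity))
    exact ⟨q, hq, hlt⟩
  choose q hqS hqlt using hex
  have hmid : ∀ a ∈ S, ∀ b ∈ S, ‖a.1 - b.1‖ ^ 2 ≤ 4 * (φ a + φ b - 2 * m) := by
    intro a ha b hb
    have h1 := hmle _ (hconv ha hb (by norm_num : (0 : ℝ) ≤ 1 / 2)
      (by norm_num : (0 : ℝ) ≤ 1 / 2) (by norm_num))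
    simp only [hφ, Prod.fst_add, Prod.snd_add, Prod.smul_fst, Prod.smul_snd, smul_eq_mul] at h1 ⊢
    rw [← smul_add, norm_smul, mul_pow, norm_add_sq_real] at h1
    rw [norm_sub_sq_real]
    norm_num at h1
    linarith
  have hlim : Tendsto (fun n : ℕ => 1 / ((n : ℝ) + 1)) atTop (𝓝 0) :=
    tendsto_one_div_add_atTop_nhds_zero_nat
  have hcauchy : CauchySeq fun n => (q n).1 := by
    refine cauchySeq_of_le_tendsto_0 (fun n : ℕ => √(8 * (1 / ((n : ℝ) + 1)))) ?_ ?_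
    · intro i j N hi hj
      rw [dist_eq_norm]
      apply Real.le_sqrt_of_sq_le
      have h1 := hmid _ (hqS i) _ (hqS j)
      have h2 : 1 / ((i : ℝ) + 1) ≤ 1 / ((N : ℝ) + 1) := one_div_le_one_div_of_le (by positivity)
        (by have : (N : ℝ) ≤ i := by exact_mod_cast hi
            linarith)
      have h3 : 1 / ((j : ℝ) + 1) ≤ 1 / ((N : ℝ) + 1) := one_div_le_one_div_of_le (by positivity)
        (by have : (N : ℝ) ≤ j := by exact_mod_cast hj
            linarith)
      linarith [hqlt i, hqlt j]
    · simpa using (hlim.const_mul 8).sqrt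
  obtain ⟨p, hp⟩ := cauchySeq_tendsto_of_complete hcauchy
  have hφlim : Tendsto (fun n => φ (q n)) atTop (𝓝 m) :=
    tendsto_of_tendsto_of_tendsto_of_le_of_le tendsto_const_nhds
      (by simpa using hlim.const_add m) (fun n => hmle _ (hqS n)) (fun n => (hqlt n).le)
  have ht : Tendsto (fun n => (q n).2) atTop (𝓝 (m - ‖p‖ ^ 2 / 2)) := by
    refine (hφlim.sub ((hp.norm.pow 2).div_const 2)).congr fun n => ?_
    simp [hφ]
  have hmem : (p, m - ‖p‖ ^ 2 / 2) ∈ S :=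
    hcl.mem_of_tendsto (hp.prodMk_nhds ht) (Eventually.of_forall hqS)
  refine ⟨_, hmem, fun a ha => ?_⟩
  have key : 0 ≤ (a.2 - (m - ‖p‖ ^ 2 / 2)) + ⟪p, a.1 - p⟫ := by
    refine nonneg_of_forall_mul_add_sq_mul_nonneg (b := ‖a.1 - p‖ ^ 2 / 2) (by positivity) ?_
    intro s hs hs1
    have h1 := hmle _ (hconv.add_smul_sub_mem hmem ha ⟨hs.le, hs1⟩)
    simp only [hφ, Prod.fst_add, Prod.snd_add, Prod.smul_fst, Prod.smul_snd, smul_eq_mul,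
      Prod.fst_sub, Prod.snd_sub] at h1
    rw [norm_add_sq_real, norm_smul, mul_pow, inner_smul_right, Real.norm_eq_abs, sq_abs] at h1
    linarith
  rw [inner_sub_right, real_inner_self_eq_norm_sq] at key
  dsimp only
  linarith

/-- A `ρ`-monotone operator is maximal if and only if its graph contains every point that is
`ρ`-monotonically related to it. -/
theorem isMaxMonotoneSV_iff {H : Type*} [NormedAddCommGroup H] [InnerProductSpace ℝ H]
    {ρ : ℝ} {A : H → Set H} :
    IsMaxMonotoneSV ρ A ↔ IsMonotoneSV ρ A ∧
      ∀ z w, (∀ y v, v ∈ A y → ρ * ‖z - y‖ ^ 2 ≤ ⟪z - y, w - v⟫) → w ∈ A z := by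
  refine and_congr_right fun hA => ⟨fun h z w hzw => ?_, fun h A' hA' hsub x => ?_⟩
  · have hmono : IsMonotoneSV ρ fun x => A x ∪ {u | x = z ∧ u = w} := by
      rintro x y u v (hu | ⟨rfl, rfl⟩) (hv | ⟨rfl, rfl⟩)
      · exact hA x y u v hu hv
      · have h1 := hzw x u hu
        rwa [norm_sub_rev, ← neg_sub x, ← neg_sub u, inner_neg_neg] at h1
      · exact hzw y v hv
      · simp
    rw [← h _ hmono (fun x => Set.subset_union_left) z]
    exact Or.inr ⟨rfl, rfl⟩
  · exact Set.Subset.antisymm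
      (fun w hw => h x w fun y v hv => hA' x y w v hw (hsub y hv)) (hsub x)

/-- Minty's theorem at the origin: the range of `Id + A` contains `0`. -/
theorem IsMaxMonotoneSV.exists_neg_mem {H : Type*} [NormedAddCommGroup H] [InnerProductSpace ℝ H]
    [CompleteSpace H] {A : H → Set H} (hA : IsMaxMonotoneSV 0 A) : ∃ x, -x ∈ A x := by
  obtain ⟨hmono, hmax⟩ := isMaxMonotoneSV_iff.1 hA
  simp only [IsMonotoneSV, zero_mul] at hmono hmax
  -- the epigraph of the Fitzpatrick function of `A`
  set S : Set (WithLp 2 (H × H) × ℝ) :=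
    {q | ∀ y v, v ∈ A y → ⟪q.1.fst, v⟫ + ⟪y, q.1.snd⟫ - ⟪y, v⟫ ≤ q.2} with hS
  have hgraph : ∀ x u, u ∈ A x → (WithLp.toLp 2 (x, u), ⟪x, u⟫) ∈ S := by
    intro x u hu y v hv
    have h1 := hmono x y u v hu hv
    simp only [inner_sub_left, inner_sub_right] at h1
    change ⟪x, v⟫ + ⟪y, u⟫ - ⟪y, v⟫ ≤ ⟪x, u⟫
    linarith
  have hfitz : ∀ q ∈ S, ⟪q.1.fst, q.1.snd⟫ ≤ q.2 := by
    intro q hq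
    by_contra! hlt
    have hmem : q.1.snd ∈ A q.1.fst := by
      refine hmax _ _ fun y v hv => ?_
      have h1 := hq y v hv
      simp only [inner_sub_left, inner_sub_right]
      linarith
    have h2 := hq _ _ hmem
    linarith
  have hne : S.Nonempty := by
    by_cases h : ∃ x u, u ∈ A x
    · obtain ⟨x, u, hu⟩ := h
      exact ⟨_, hgraph x u hu⟩
    · push Not at h
      exact ⟨_, hgraph 0 0 (hmax 0 0 fun y v hv => absurd hv (h y v))⟩
  have hcl : IsClosed S := by
    simp only [hS, Set.ofPred_forall]
    refine isClosed_iInter fun y => isClosed_iInter fun v => isClosed_iInter fun _ => ?_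
    exact isClosed_le (by fun_prop) (by fun_prop)
  have hconv : Convex ℝ S := by
    intro a ha b hb s t hs ht hst y v hv
    have h1 := mul_le_mul_of_nonneg_left (ha y v hv) hs
    have h2 := mul_le_mul_of_nonneg_left (hb y v hv) ht
    simp only [Prod.fst_add, Prod.snd_add, Prod.smul_fst, Prod.smul_snd, smul_eq_mul,
      WithLp.add_fst, WithLp.add_snd, WithLp.smul_fst, WithLp.smul_snd, inner_add_left,
      inner_add_right, real_inner_smul_left, real_inner_smul_right]
    linear_combination h1 + h2 + ⟪y, v⟫ * hst
  have hnorm : ∀ p : WithLp 2 (H × H), ‖p‖ ^ 2 = ‖p.fst‖ ^ 2 + ‖p.snd‖ ^ 2 :=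
    WithLp.prod_norm_sq_eq_of_L2
  have hbdd : ∀ q ∈ S, 0 ≤ q.2 + ‖q.1‖ ^ 2 / 2 := by
    intro q hq
    have h1 := hfitz q hq
    have h2 := sq_nonneg ‖q.1.fst + q.1.snd‖
    rw [norm_add_sq_real] at h2
    rw [hnorm]
    linarith
  obtain ⟨⟨p, t⟩, hqS, hvar⟩ := exists_variational_inequality hne hcl hconv hbdd
  have hsum := norm_add_sq_real p.fst p.snd
  have hkey : ∀ x u, u ∈ A x → ‖p.fst + p.snd‖ ^ 2 ≤ ⟪x + p.snd, u + p.fst⟫ := by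
    intro x u hu
    have h1 : t + ‖p‖ ^ 2 ≤ ⟪x, u⟫ + (⟪p.fst, x⟫ + ⟪p.snd, u⟫) := hvar _ (hgraph x u hu)
    have h2 : ⟪p.fst, p.snd⟫ ≤ t := hfitz _ hqS
    rw [hnorm] at h1
    simp only [inner_add_left, inner_add_right]
    have h3 := real_inner_comm x p.fst
    have h4 := real_inner_comm p.fst p.snd
    linarith
  have hmem : -p.fst ∈ A (-p.snd) := by
    refine hmax _ _ fun y v hv => ?_
    have h1 := (sq_nonneg _).trans (hkey y v hv)
    rwa [← inner_neg_neg, neg_add', neg_add', sub_eq_add_neg, sub_eq_add_neg,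
      add_comm (-y), add_comm (-v), ← sub_eq_add_neg, ← sub_eq_add_neg] at h1
  have h0 := hkey _ _ hmem
  simp only [neg_add_cancel, inner_zero_left] at h0
  have h1 : p.fst + p.snd = 0 := by
    rw [← norm_eq_zero]
    exact pow_eq_zero_iff two_ne_zero |>.1 (le_antisymm h0 (sq_nonneg _))
  refine ⟨-p.snd, ?_⟩
  rwa [eq_neg_of_add_eq_zero_left h1] at hmem

/-- Minty's theorem for a maximally `ρ`-monotone operator. -/
theorem IsMaxMonotoneSV.exists_sub_smul_mem {H : Type*} [NormedAddCommGroup H]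
    [InnerProductSpace ℝ H] [CompleteSpace H] {ρ : ℝ} {A : H → Set H} (hA : IsMaxMonotoneSV ρ A)
    {t : ℝ} (ht : 0 < t + ρ) (b : H) : ∃ x, b - t • x ∈ A x := by
  obtain ⟨hmono, hmax⟩ := isMaxMonotoneSV_iff.1 hA
  have hinner : ∀ x y u v : H,
      ⟪x - y, ((t + ρ) • u + ρ • x + b) - ((t + ρ) • v + ρ • y + b)⟫ =
        (t + ρ) * ⟪x - y, u - v⟫ + ρ * ‖x - y‖ ^ 2 := by
    intro x y u v
    rw [← real_inner_self_eq_norm_sq, ← real_inner_smul_right, ← real_inner_smul_right,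
      ← inner_add_right]
    congr 1
    module
  have hB : IsMaxMonotoneSV 0 fun x => {u | (t + ρ) • u + ρ • x + b ∈ A x} := by
    refine isMaxMonotoneSV_iff.2 ⟨fun x y u v hu hv => ?_, fun z w hzw => hmax _ _ fun y v hv => ?_⟩
    · have h1 := hmono _ _ _ _ hu hv
      rw [hinner] at h1
      rw [zero_mul]
      exact nonneg_of_mul_nonneg_right (by linarith : 0 ≤ (t + ρ) * ⟪x - y, u - v⟫) ht
    · have hv' : v = (t + ρ) • ((t + ρ)⁻¹ • (v - ρ • y - b)) + ρ • y + b := by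
        rw [smul_inv_smul₀ ht.ne']
        abel
      have h1 := hzw y ((t + ρ)⁻¹ • (v - ρ • y - b)) (by rwa [Set.mem_ofPred_eq, ← hv'])
      rw [hv', hinner]
      rw [zero_mul] at h1
      linarith [mul_nonneg ht.le h1]
  obtain ⟨x, hx⟩ := hB.exists_neg_mem
  refine ⟨x, ?_⟩
  rw [Set.mem_ofPred_eq] at hx
  convert hx using 1
  module

/-- A monotone sum of a maximally `ρ`-monotone operator and a Lipschitz map is maximally
monotone. -/
theorem IsMaxMonotoneSV.add_isLipBound {H : Type*} [NormedAddCommGroup H] [InnerProductSpace ℝ H]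
    [CompleteSpace H] {ρ k : ℝ} {A : H → Set H} {D : H → H} (hA : IsMaxMonotoneSV ρ A)
    (hD : IsLipBound k D) (hmono : IsMonotoneSV 0 fun x => (fun u => u + D x) '' A x) :
    IsMaxMonotoneSV 0 fun x => (fun u => u + D x) '' A x := by
  refine isMaxMonotoneSV_iff.2 ⟨hmono, fun z w hzw => ?_⟩
  obtain ⟨t, htρ, htk⟩ : ∃ t : ℝ, 0 < t + ρ ∧ k < t :=
    ⟨max (-ρ) k + 1, by linarith [le_max_left (-ρ) k], by linarith [le_max_right (-ρ) k]⟩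
  obtain ⟨x, hx⟩ := hA.exists_sub_smul_mem htρ (w - D z + t • z)
  have h1 := hzw x _ ⟨_, hx, rfl⟩
  have h2 : w - (w - D z + t • z - t • x + D x) = (D z - D x) - t • (z - x) := by module
  rw [zero_mul, h2, inner_sub_right, real_inner_smul_right, real_inner_self_eq_norm_sq] at h1
  have h3 := real_inner_le_norm (z - x) (D z - D x)
  have h4 := mul_le_mul_of_nonneg_left (hD z x) (norm_nonneg (z - x))
  have h5 : ‖z - x‖ ^ 2 = 0 := le_antisymm (by nlinarith) (sq_nonneg _)
  obtain rfl : z = x := sub_eq_zero.1 (norm_eq_zero.1 (pow_eq_zero_iff two_ne_zero |>.1 h5))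
  exact ⟨_, hx, by simp⟩

theorem lambdaMin_mul_norm_sq_le {H G : Type*} [NormedAddCommGroup H] [InnerProductSpace ℝ H]
    [NormedAddCommGroup G] [InnerProductSpace ℝ G] (L : H →L[ℝ] G) (K : G →L[ℝ] H) (x : H) :
    lambdaMin L K * ‖x‖ ^ 2 ≤ ⟪x, K (L x)⟫ := by
  rcases eq_or_ne x 0 with rfl | hx
  · simp
  have hx' : 0 < ‖x‖ := norm_pos_iff.2 hx
  have hbelow : BddBelow {r : ℝ | ∃ x : H, ‖x‖ = 1 ∧ r = ⟪x, K (L x)⟫} := by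
    refine ⟨-‖K.comp L‖, ?_⟩
    rintro _ ⟨y, hy, rfl⟩
    have h1 := (abs_le.1 (abs_real_inner_le_norm y (K (L y)))).1
    have h2 := (K.comp L).le_opNorm y
    rw [ContinuousLinearMap.comp_apply, hy, mul_one] at h2
    rw [hy, one_mul] at h1
    linarith
  have h1 : lambdaMin L K ≤ ⟪‖x‖⁻¹ • x, K (L (‖x‖⁻¹ • x))⟫ :=
    csInf_le hbelow ⟨_, by rw [norm_smul, norm_inv, norm_norm, inv_mul_cancel₀ hx'.ne'], rfl⟩
  rw [map_smul, map_smul, real_inner_smul_left, real_inner_smul_right] at h1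
  calc lambdaMin L K * ‖x‖ ^ 2 ≤ ‖x‖⁻¹ * (‖x‖⁻¹ * ⟪x, K (L x)⟫) * ‖x‖ ^ 2 := by gcongr
    _ = ⟪x, K (L x)⟫ := by field_simp

theorem Dop_sub {H G : Type*} [NormedAddCommGroup H] [InnerProductSpace ℝ H]
    [NormedAddCommGroup G] [InnerProductSpace ℝ G] (α : ℝ) (L : H →L[ℝ] G) (c : G) (B : G → G)
    (M : G →L[ℝ] H) (x y : H) :
    Dop α L c B M x - Dop α L c B M y = α • M (L (x - y)) + M (B (L x) - B (L y)) := by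
  simp only [Dop, map_sub]
  module

theorem Dop_isLipBound {H G : Type*} [NormedAddCommGroup H] [InnerProductSpace ℝ H]
    [NormedAddCommGroup G] [InnerProductSpace ℝ G] {ζ : ℝ} (hζ : 0 ≤ ζ) (α : ℝ) (L : H →L[ℝ] G)
    (c : G) {B : G → G} (hB : IsLipBound ζ B) (M : G →L[ℝ] H) :
    IsLipBound (|α| * (‖M‖ * ‖L‖) + ‖M‖ * (ζ * ‖L‖)) (Dop α L c B M) := by
  intro x y
  have hL := L.le_opNorm (x - y)
  rw [Dop_sub]
  calc ‖α • M (L (x - y)) + M (B (L x) - B (L y))‖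
      ≤ |α| * ‖M (L (x - y))‖ + ‖M (B (L x) - B (L y))‖ := by
        refine (norm_add_le _ _).trans_eq ?_
        rw [norm_smul, Real.norm_eq_abs]
    _ ≤ |α| * (‖M‖ * (‖L‖ * ‖x - y‖)) + ‖M‖ * (ζ * (‖L‖ * ‖x - y‖)) := by
        gcongr
        · exact M.le_opNorm_of_le hL
        · refine M.le_opNorm_of_le ((hB _ _).trans ?_)
          rw [← map_sub]
          gcongr
    _ = (|α| * (‖M‖ * ‖L‖) + ‖M‖ * (ζ * ‖L‖)) * ‖x - y‖ := by ring

theorem le_inner_Dop_sub {H G : Type*} [NormedAddCommGroup H] [InnerProductSpace ℝ H]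
    [CompleteSpace H] [NormedAddCommGroup G] [InnerProductSpace ℝ G] [CompleteSpace G]
    {α ζt : ℝ} (hα : 0 ≤ α) {B : G → G} (hB : IsMonotoneMap B) {L : H →L[ℝ] G} {K : G →L[ℝ] H}
    (c : G) (hζt : IsLipBound ζt fun x : H => (ContinuousLinearMap.adjoint L - K) (B (L x)))
    (x y : H) :
    (α * lambdaMin L K - ζt) * ‖x - y‖ ^ 2 ≤ ⟪x - y, Dop α L c B K x - Dop α L c B K y⟫ := by
  have h1 := mul_le_mul_of_nonneg_left (lambdaMin_mul_norm_sq_le L K (x - y)) hα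
  have h2 := hB (L x) (L y)
  rw [← map_sub, ← ContinuousLinearMap.adjoint_inner_right] at h2
  have h3 := hζt x y
  rw [← map_sub] at h3
  have h4 := (real_inner_le_norm (x - y) _).trans
    (mul_le_mul_of_nonneg_left h3 (norm_nonneg (x - y)))
  rw [sub_apply, inner_sub_right] at h4
  rw [Dop_sub, inner_add_right, real_inner_smul_right]
  linarith

theorem statement0 {H G : Type*} [NormedAddCommGroup H] [InnerProductSpace ℝ H] [CompleteSpace H]
    [NormedAddCommGroup G] [InnerProductSpace ℝ G] [CompleteSpace G]
    (ρ β ζ α : ℝ) (A : H → Set H) (C : H → H) (B : G → G)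
    (L : H →L[ℝ] G) (K : G →L[ℝ] H) (c : G)
    (hA : IsMaxMonotoneSV ρ A)
    (hβ : 0 < β) (hC : IsCocoercive β C)
    (hζ : 0 < ζ) (hBmono : IsMonotoneMap B) (hBlip : IsLipBound ζ B)
    (hα : 0 ≤ α)
    (ζt : ℝ)
    (hζt : IsLipConst ζt (fun x : H => (ContinuousLinearMap.adjoint L - K) (B (L x))))
    (hρhat : 0 ≤ (ρ + α * lambdaMin L K - ζt)) :
    IsMaxMonotoneSV 0 (fun x => (fun u => u + Dop α L c B K x) '' A x) ∧
      ∀ x y u v, u ∈ A x → v ∈ A y →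
        (ρ + α * lambdaMin L K - ζt) * ‖x - y‖ ^ 2 ≤
            ⟪x - y, (u + Dop α L c B K x) - (v + Dop α L c B K y)⟫ ∧
          0 ≤ (ρ + α * lambdaMin L K - ζt) * ‖x - y‖ ^ 2 := by
  have hineq : ∀ x y u v, u ∈ A x → v ∈ A y →
      (ρ + α * lambdaMin L K - ζt) * ‖x - y‖ ^ 2 ≤
        ⟪x - y, (u + Dop α L c B K x) - (v + Dop α L c B K y)⟫ := by
    intro x y u v hu hv
    have h1 := hA.1 x y u v hu hv
    have h2 := le_inner_Dop_sub hα hBmono c hζt.1 x y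
    rw [add_sub_add_comm, inner_add_right]
    linarith
  have hnonneg : ∀ x y : H, 0 ≤ (ρ + α * lambdaMin L K - ζt) * ‖x - y‖ ^ 2 :=
    fun x y => mul_nonneg hρhat (sq_nonneg _)
  refine ⟨hA.add_isLipBound (Dop_isLipBound hζ.le α L c hBlip K) ?_,
    fun x y u v hu hv => ⟨hineq x y u v hu hv, hnonneg x y⟩⟩
  rintro x y _ _ ⟨u, hu, rfl⟩ ⟨v, hv, rfl⟩
  rw [zero_mul]
  exact (hnonneg x y).trans (hineq x y u v hu hv)
end
end

section
/- Under the stated perturbed fixed-point iteration hypotheses, for every z* ∈ S the following hold: (1) the real sequence (‖z_n − z*‖) converges; (2) ∑_{n} ‖z_{n+1} − Q^{γ_n} z_n‖ < +∞; (3) ∑_{n} φ^{γ_n}(z_n) < +∞. -/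
open Filter Topology
open scoped RealInnerProductSpace Pointwise

noncomputable section

open Finset in
/-- Discrete Grönwall inequality with summable perturbations. -/
theorem exists_bound_of_le_one_add_mul_add {a α β : ℕ → ℝ} (hα₀ : ∀ n, 0 ≤ α n)
    (hα : Summable α) (hβ₀ : ∀ n, 0 ≤ β n) (hβ : Summable β) (ha₀ : 0 ≤ a 0)
    (ha : ∀ n, a (n + 1) ≤ (1 + α n) * a n + β n) : ∃ M, ∀ n, a n ≤ M := by
  have key : ∀ n, a n ≤ Real.exp (∑ k ∈ range n, α k) * (a 0 + ∑ k ∈ range n, β k) := by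
    intro n
    induction n with
    | zero => simp
    | succ n ih =>
      have hE : 1 ≤ Real.exp (∑ k ∈ range (n + 1), α k) :=
        Real.one_le_exp (sum_nonneg fun k _ => hα₀ k)
      have hexp : 1 + α n ≤ Real.exp (α n) := by linarith [Real.add_one_le_exp (α n)]
      have hB : 0 ≤ Real.exp (∑ k ∈ range n, α k) * (a 0 + ∑ k ∈ range n, β k) :=
        mul_nonneg (Real.exp_pos _).le (add_nonneg ha₀ (sum_nonneg fun k _ => hβ₀ k))
      calc a (n + 1) ≤ (1 + α n) * a n + β n := ha n
        _ ≤ Real.exp (α n) * (Real.exp (∑ k ∈ range n, α k) * (a 0 + ∑ k ∈ range n, β k))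
            + Real.exp (∑ k ∈ range (n + 1), α k) * β n :=
          add_le_add
            ((mul_le_mul_of_nonneg_left ih (by linarith [hα₀ n])).trans
              (mul_le_mul_of_nonneg_right hexp hB))
            (le_mul_of_one_le_left (hβ₀ n) hE)
        _ = _ := by rw [sum_range_succ α, sum_range_succ β, Real.exp_add]; ring
  refine ⟨Real.exp (∑' k, α k) * (a 0 + ∑' k, β k), fun n => (key n).trans ?_⟩
  have h₁ := hα.sum_le_tsum (range n) fun k _ => hα₀ k
  have h₂ := hβ.sum_le_tsum (range n) fun k _ => hβ₀ k
  have h₃ : 0 ≤ ∑ k ∈ range n, β k := sum_nonneg fun k _ => hβ₀ k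
  gcongr

open Finset in
/-- A nonnegative sequence whose increments are bounded above by a summable sequence converges. -/
theorem exists_tendsto_of_le_add {a e : ℕ → ℝ} (ha₀ : ∀ n, 0 ≤ a n) (he₀ : ∀ n, 0 ≤ e n)
    (he : Summable e) (ha : ∀ n, a (n + 1) ≤ a n + e n) : ∃ l, Tendsto a atTop (𝓝 l) := by
  have hanti : Antitone fun n => a n - ∑ k ∈ range n, e k := by
    refine antitone_nat_of_succ_le fun n => ?_
    rw [sum_range_succ]
    linarith [ha n]
  have hbdd : BddBelow (Set.range fun n => a n - ∑ k ∈ range n, e k) := by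
    refine ⟨-∑' k, e k, ?_⟩
    rintro _ ⟨n, rfl⟩
    have := he.sum_le_tsum (range n) fun k _ => he₀ k
    dsimp only
    linarith [ha₀ n]
  refine ⟨_, ((tendsto_atTop_ciInf hanti hbdd).add he.hasSum.tendsto_sum_nat).congr fun n => ?_⟩
  ring

open Finset in
/-- A nonnegative sequence dominated by the decrements of a nonnegative sequence plus a summable
sequence is summable. -/
theorem summable_of_le_sub_add {b e f : ℕ → ℝ} (hb₀ : ∀ n, 0 ≤ b n) (he₀ : ∀ n, 0 ≤ e n)
    (he : Summable e) (hf₀ : ∀ n, 0 ≤ f n) (hf : ∀ n, f n ≤ b n - b (n + 1) + e n) :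
    Summable f := by
  refine summable_of_sum_range_le (c := b 0 + ∑' k, e k) hf₀ fun n => ?_
  have h₁ := sum_le_sum fun k (_ : k ∈ range n) => hf k
  rw [sum_add_distrib, sum_range_sub'] at h₁
  linarith [he.sum_le_tsum (range n) fun k _ => he₀ k, hb₀ n]

theorem statement4 {H : Type*} [NormedAddCommGroup H] [InnerProductSpace ℝ H]
    [CompleteSpace H]
    (I : Set ℝ) (hI : I ⊆ Set.Ioi (0:ℝ)) (S : Set H) (hS : S.Nonempty)
    (Q : ℝ → H → H) (φ : ℝ → H → ℝ)
    (hφ : ∀ γ ∈ I, ∀ z : H, 0 ≤ φ γ z)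
    (hQ : ∀ γ ∈ I, ∀ z : H, ∀ zs ∈ S, ‖Q γ z - zs‖ ^ 2 ≤ ‖z - zs‖ ^ 2 - φ γ z)
    (varpi η : H → ℕ → ℝ)
    (hvarpi : ∀ zs ∈ S, (∀ n, 0 ≤ varpi zs n) ∧ Summable (varpi zs))
    (hη : ∀ zs ∈ S, (∀ n, 0 ≤ η zs n) ∧ Summable (η zs))
    (Qn : ℕ → ℝ → H → H)
    (hQn : ∀ n, ∀ γ ∈ I, ∀ z : H, ∀ zs ∈ S,
      ‖Qn n γ z - Q γ z‖ ≤ varpi zs n * ‖z - zs‖ + η zs n)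
    (γ : ℕ → ℝ) (hγ : ∀ n, γ n ∈ I)
    (z : ℕ → H) (hz : ∀ n, z (n + 1) = Qn n (γ n) (z n)) :
    ∀ zs ∈ S,
      (∃ l : ℝ, Tendsto (fun n => ‖z n - zs‖) atTop (𝓝 l)) ∧
      Summable (fun n => ‖z (n + 1) - Q (γ n) (z n)‖) ∧
      Summable (fun n => φ (γ n) (z n)) := by
  intro zs hzs
  obtain ⟨hϖ₀, hϖ⟩ := hvarpi zs hzs
  obtain ⟨hη₀, hη'⟩ := hη zs hzs
  have he : ∀ n, ‖z (n + 1) - Q (γ n) (z n)‖ ≤ varpi zs n * ‖z n - zs‖ + η zs n := fun n => by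
    rw [hz n]
    exact hQn n (γ n) (hγ n) (z n) zs hzs
  have hq : ∀ n, ‖Q (γ n) (z n) - zs‖ ≤ ‖z n - zs‖ := fun n =>
    le_of_sq_le_sq (by linarith [hQ (γ n) (hγ n) (z n) zs hzs, hφ (γ n) (hγ n) (z n)])
      (norm_nonneg _)
  have htri : ∀ n, ‖z (n + 1) - zs‖ ≤
      ‖Q (γ n) (z n) - zs‖ + ‖z (n + 1) - Q (γ n) (z n)‖ := fun n => by
    linarith [norm_sub_le_norm_sub_add_norm_sub (z (n + 1)) (Q (γ n) (z n)) zs]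
  obtain ⟨M, hM⟩ := exists_bound_of_le_one_add_mul_add (a := fun n => ‖z n - zs‖) hϖ₀ hϖ hη₀ hη'
    (norm_nonneg _) fun n => by linarith [he n, hq n, htri n]
  have hsum : Summable fun n => ‖z (n + 1) - Q (γ n) (z n)‖ :=
    Summable.of_nonneg_of_le (fun _ => norm_nonneg _)
      (fun n => (he n).trans
        (add_le_add_left (mul_le_mul_of_nonneg_left (hM n) (hϖ₀ n)) (η zs n)))
      ((hϖ.mul_right M).add hη')
  refine ⟨exists_tendsto_of_le_add (fun _ => norm_nonneg _) (fun _ => norm_nonneg _) hsum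
    fun n => (htri n).trans (add_le_add_left (hq n) _), hsum, ?_⟩
  have hM₀ : 0 ≤ M := (norm_nonneg _).trans (hM 0)
  refine summable_of_le_sub_add (b := fun n => ‖z n - zs‖ ^ 2) (fun _ => sq_nonneg _)
    (fun n => mul_nonneg (norm_nonneg _) (add_nonneg hM₀ hM₀)) (hsum.mul_right (M + M))
    (fun n => hφ (γ n) (hγ n) (z n)) fun n => ?_
  have hsq : ‖z (n + 1) - zs‖ ^ 2 - ‖Q (γ n) (z n) - zs‖ ^ 2 ≤
      ‖z (n + 1) - Q (γ n) (z n)‖ * (M + M) := by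
    rw [sq_sub_sq, mul_comm]
    exact mul_le_mul (by linarith [htri n]) (add_le_add (hM (n + 1)) ((hq n).trans (hM n)))
      (by positivity) (norm_nonneg _)
  linarith [hQ (γ n) (hγ n) (z n) zs hzs]
end
end

section
/- Under the stated perturbed fixed-point iteration hypotheses, if every weak sequential cluster point of (z_n) belongs to S, then (z_n) converges weakly to a point of S, i.e. there exists z̄ ∈ S such that ⟪z_n, w⟫ → ⟪z̄, w⟫ for every w ∈ H. -/
open Filter Topology
open scoped RealInnerProductSpace Pointwise

noncomputable section


/-- A nonnegative real sequence that is nonincreasing up to summable multiplicative and additive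
perturbations converges. -/
theorem exists_tendsto_of_le_one_add_mul_add {a p q : ℕ → ℝ} (ha : ∀ n, 0 ≤ a n)
    (hp : ∀ n, 0 ≤ p n) (hq : ∀ n, 0 ≤ q n) (hps : Summable p) (hqs : Summable q)
    (h : ∀ n, a (n + 1) ≤ (1 + p n) * a n + q n) :
    ∃ l, Tendsto a atTop (𝓝 l) := by
  have hexp : ∀ n, a n ≤
      Real.exp (∑ i ∈ Finset.range n, p i) * (a 0 + ∑ i ∈ Finset.range n, q i) := by
    intro n
    induction n with
    | zero => simp
    | succ n ih =>
      rw [Finset.sum_range_succ, Finset.sum_range_succ, Real.exp_add]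
      have h1 : 1 + p n ≤ Real.exp (p n) := by linarith [Real.add_one_le_exp (p n)]
      have h2 : 1 ≤ Real.exp (∑ i ∈ Finset.range n, p i) * Real.exp (p n) := by
        rw [← Real.exp_add, Real.one_le_exp_iff]
        exact add_nonneg (Finset.sum_nonneg fun i _ => hp i) (hp n)
      calc a (n + 1) ≤ (1 + p n) * a n + q n := h n
        _ ≤ Real.exp (p n) * (Real.exp (∑ i ∈ Finset.range n, p i) *
              (a 0 + ∑ i ∈ Finset.range n, q i)) +
              Real.exp (∑ i ∈ Finset.range n, p i) * Real.exp (p n) * q n :=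
            add_le_add (mul_le_mul h1 ih (ha n) (Real.exp_pos _).le)
              (le_mul_of_one_le_left (hq n) h2)
        _ = _ := by ring
  set M := Real.exp (∑' i, p i) * (a 0 + ∑' i, q i)
  have hM : ∀ n, a n ≤ M := fun n =>
    (hexp n).trans <| mul_le_mul
      (Real.exp_le_exp.2 (hps.sum_le_tsum _ fun i _ => hp i))
      (add_le_add_right (hqs.sum_le_tsum _ fun i _ => hq i) _)
      (add_nonneg (ha 0) (Finset.sum_nonneg fun i _ => hq i)) (Real.exp_pos _).le
  have hes : Summable fun n => p n * M + q n := (hps.mul_right M).add hqs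
  have hanti : Antitone fun n => a n - ∑ i ∈ Finset.range n, (p i * M + q i) := by
    refine antitone_nat_of_succ_le fun n => ?_
    rw [Finset.sum_range_succ]
    linarith [h n, mul_le_mul_of_nonneg_left (hM n) (hp n)]
  have hbdd : BddBelow (Set.range fun n => a n - ∑ i ∈ Finset.range n, (p i * M + q i)) := by
    refine ⟨-∑' i, (p i * M + q i), ?_⟩
    rintro _ ⟨n, rfl⟩
    have hsum : ∑ i ∈ Finset.range n, (p i * M + q i) ≤ ∑' i, (p i * M + q i) :=
      hes.sum_le_tsum _ fun i _ =>
        add_nonneg (mul_nonneg (hp i) ((ha 0).trans (hM 0))) (hq i)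
    dsimp only
    linarith [ha n]
  exact ⟨_, ((tendsto_atTop_ciInf hanti hbdd).add hes.hasSum.tendsto_sum_nat).congr
    fun n => sub_add_cancel _ _⟩

/-- A bounded sequence in a Hilbert space has a weakly convergent subsequence. -/
theorem exists_strictMono_tendsto_inner_of_norm_le {H : Type*} [NormedAddCommGroup H]
    [InnerProductSpace ℝ H] [CompleteSpace H] {z : ℕ → H} {M : ℝ} (hM : ∀ n, ‖z n‖ ≤ M) :
    ∃ w : H, ∃ σ : ℕ → ℕ, StrictMono σ ∧
      ∀ v : H, Tendsto (fun n => ⟪z (σ n), v⟫) atTop (𝓝 ⟪w, v⟫) := by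
  let K : Submodule ℝ H := (Submodule.span ℝ (Set.range z)).topologicalClosure
  have hK : IsClosed (K : Set H) := Submodule.isClosed_topologicalClosure _
  have : CompleteSpace K := hK.completeSpace_coe
  have hsep : TopologicalSpace.IsSeparable (K : Set H) := by
    rw [Submodule.topologicalClosure_coe]
    exact (Set.countable_range z).isSeparable.span.closure
  have : TopologicalSpace.SeparableSpace K := hsep.separableSpace
  have hzK : ∀ n, z n ∈ K := fun n =>
    Submodule.le_topologicalClosure _ (Submodule.subset_span ⟨n, rfl⟩)
  let y : ℕ → K := fun n => ⟨z n, hzK n⟩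
  have hball : ∀ n, StrongDual.toWeakDual (InnerProductSpace.toDual ℝ K (y n)) ∈
      WeakDual.toStrongDual ⁻¹' Metric.closedBall (0 : StrongDual ℝ K) M := fun n =>
    mem_closedBall_zero_iff.2 <| ((InnerProductSpace.toDual ℝ K).norm_map (y n)).trans_le (hM n)
  obtain ⟨f, -, σ, hσ, hf⟩ := WeakDual.isSeqCompact_closedBall ℝ K 0 M hball
  refine ⟨((InnerProductSpace.toDual ℝ K).symm (WeakDual.toStrongDual f) : K), σ, hσ,
    fun v => ?_⟩
  have hproj : ∀ u : K, ⟪(u : H), v⟫ = ⟪u, K.orthogonalProjectionOnto v⟫ := fun u => by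
    simp
  have hv := ((WeakDual.eval_continuous (K.orthogonalProjectionOnto v)).tendsto f).comp hf
  rw [hproj, InnerProductSpace.toDual_symm_apply]
  refine hv.congr fun n => ?_
  exact (hproj (y (σ n))).symm

/-- **Opial's lemma**: if the distances from a sequence to each point of a nonempty set `S`
converge and all weak sequential cluster points lie in `S`, then the sequence converges weakly
to a point of `S`. -/
theorem exists_tendsto_inner_of_tendsto_norm_sub {H : Type*} [NormedAddCommGroup H]
    [InnerProductSpace ℝ H] [CompleteSpace H] {S : Set H} (hS : S.Nonempty) {z : ℕ → H}
    (hdist : ∀ x ∈ S, ∃ l, Tendsto (fun n => ‖z n - x‖) atTop (𝓝 l))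
    (hcluster : ∀ w : H,
      (∃ σ : ℕ → ℕ, StrictMono σ ∧
        ∀ v : H, Tendsto (fun n => ⟪z (σ n), v⟫) atTop (𝓝 ⟪w, v⟫)) → w ∈ S) :
    ∃ zb ∈ S, ∀ w : H, Tendsto (fun n => ⟪z n, w⟫) atTop (𝓝 ⟪zb, w⟫) := by
  obtain ⟨M, hM⟩ : ∃ M, ∀ n, ‖z n‖ ≤ M := by
    obtain ⟨x, hx⟩ := hS
    obtain ⟨l, hl⟩ := hdist x hx
    obtain ⟨B, hB⟩ := hl.bddAbove_range
    refine ⟨B + ‖x‖, fun n => ?_⟩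
    have hn : ‖z n - x‖ ≤ B := hB ⟨n, rfl⟩
    linarith [norm_le_norm_sub_add (z n) x]
  obtain ⟨x, σ, hσ, hx⟩ := exists_strictMono_tendsto_inner_of_norm_le hM
  have hxS : x ∈ S := hcluster x ⟨σ, hσ, hx⟩
  refine ⟨x, hxS, fun w => tendsto_of_subseq_tendsto fun ns hns => ?_⟩
  obtain ⟨τ, -, hτ⟩ := strictMono_subseq_of_tendsto_atTop hns
  obtain ⟨y, ρ, hρ, hy⟩ := exists_strictMono_tendsto_inner_of_norm_le
    (z := fun n => z (ns (τ n))) fun n => hM _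
  have hyS : y ∈ S := hcluster y ⟨_, hτ.comp hρ, hy⟩
  obtain ⟨l, hl⟩ := hdist x hxS
  obtain ⟨m, hm⟩ := hdist y hyS
  have hlim : Tendsto (fun n => ⟪z n, x - y⟫) atTop
      (𝓝 ((m ^ 2 - l ^ 2 + ‖x‖ ^ 2 - ‖y‖ ^ 2) / 2)) := by
    refine (((((hm.pow 2).sub (hl.pow 2)).add_const _).sub_const _).div_const 2).congr
      fun n => ?_
    rw [norm_sub_sq_real, norm_sub_sq_real, inner_sub_right]
    ring
  have hxy : ⟪x - y, x - y⟫ = 0 := by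
    rw [inner_sub_left, sub_eq_zero]
    exact (tendsto_nhds_unique (hx _) (hlim.comp hσ.tendsto_atTop)).trans
      (tendsto_nhds_unique (hy _) (hlim.comp (hτ.comp hρ).tendsto_atTop)).symm
  obtain rfl : x = y := sub_eq_zero.1 (inner_self_eq_zero.1 hxy)
  exact ⟨τ ∘ ρ, hy w⟩

theorem statement5 {H : Type*} [NormedAddCommGroup H] [InnerProductSpace ℝ H]
    [CompleteSpace H]
    (I : Set ℝ) (hI : I ⊆ Set.Ioi (0:ℝ)) (S : Set H) (hS : S.Nonempty)
    (Q : ℝ → H → H) (φ : ℝ → H → ℝ)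
    (hφ : ∀ γ ∈ I, ∀ z : H, 0 ≤ φ γ z)
    (hQ : ∀ γ ∈ I, ∀ z : H, ∀ zs ∈ S, ‖Q γ z - zs‖ ^ 2 ≤ ‖z - zs‖ ^ 2 - φ γ z)
    (varpi η : H → ℕ → ℝ)
    (hvarpi : ∀ zs ∈ S, (∀ n, 0 ≤ varpi zs n) ∧ Summable (varpi zs))
    (hη : ∀ zs ∈ S, (∀ n, 0 ≤ η zs n) ∧ Summable (η zs))
    (Qn : ℕ → ℝ → H → H)
    (hQn : ∀ n, ∀ γ ∈ I, ∀ z : H, ∀ zs ∈ S,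
      ‖Qn n γ z - Q γ z‖ ≤ varpi zs n * ‖z - zs‖ + η zs n)
    (γ : ℕ → ℝ) (hγ : ∀ n, γ n ∈ I)
    (z : ℕ → H) (hz : ∀ n, z (n + 1) = Qn n (γ n) (z n))
    (hcluster : ∀ w : H,
      (∃ σ : ℕ → ℕ, StrictMono σ ∧
        ∀ v : H, Tendsto (fun n => ⟪z (σ n), v⟫) atTop (𝓝 ⟪w, v⟫)) → w ∈ S) :
    ∃ zb ∈ S, ∀ w : H, Tendsto (fun n => ⟪z n, w⟫) atTop (𝓝 ⟪zb, w⟫) := by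
  refine exists_tendsto_inner_of_tendsto_norm_sub hS (fun x hx => ?_) hcluster
  refine exists_tendsto_of_le_one_add_mul_add (fun n => norm_nonneg _) (hvarpi x hx).1
    (hη x hx).1 (hvarpi x hx).2 (hη x hx).2 fun n => ?_
  have hquasi : ‖Q (γ n) (z n) - x‖ ≤ ‖z n - x‖ :=
    (abs_le_of_sq_le_sq' (by linarith [hQ _ (hγ n) (z n) x hx, hφ _ (hγ n) (z n)]) (norm_nonneg _)).2
  have hpert := hQn n _ (hγ n) (z n) x hx
  rw [hz n]
  linarith [norm_sub_le_norm_sub_add_norm_sub (Qn n (γ n) (z n)) (Q (γ n) (z n)) x]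
end
end

section
/- Let ϑ, η̄ ∈ (0,1), η₀ ∈ [0,∞), let (ϖ_n)_{n∈ℕ} be a sequence in [0,∞) with ϖ_n → 0, and let (a_n)_{n∈ℕ} be a sequence in [0,∞) satisfying a_{n+1} ≤ (ϑ + ϖ_n)a_n + η₀·η̄ⁿ for every n ∈ ℕ. Then (a_n) converges linearly to 0: there exist c ∈ [0,∞) and r ∈ [0,1) such that a_n ≤ c·rⁿ for all n ∈ ℕ. -/
open Filter Topology
open scoped RealInnerProductSpace Pointwise

noncomputable section


theorem statement6 (vth etab eta0 : ℝ)
    (hvth0 : 0 < vth) (hvth1 : vth < 1)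
    (hetab0 : 0 < etab) (hetab1 : etab < 1) (heta0 : 0 ≤ eta0)
    (varpi : ℕ → ℝ) (hvarpi : ∀ n, 0 ≤ varpi n)
    (hvarpi0 : Tendsto varpi atTop (𝓝 0))
    (a : ℕ → ℝ) (ha : ∀ n, 0 ≤ a n)
    (hrec : ∀ n, a (n + 1) ≤ (vth + varpi n) * a n + eta0 * etab ^ n) :
    ∃ c r : ℝ, 0 ≤ c ∧ 0 ≤ r ∧ r < 1 ∧ ∀ n, a n ≤ c * r ^ n := by
  obtain ⟨q, hq, hq1⟩ := exists_between hvth1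
  obtain ⟨r, hr, hr1⟩ := exists_between (max_lt hq1 hetab1)
  obtain ⟨hqr, hetar⟩ := max_lt_iff.mp hr
  have hr0 : 0 < r := hetab0.trans hetar
  obtain ⟨N, hN⟩ := eventually_atTop.mp (hvarpi0.eventually_lt_const (sub_pos.mpr hq))
  set S := ∑ k ∈ Finset.range (N + 1), a k / r ^ k
  have hS_terms : ∀ k, 0 ≤ a k / r ^ k := fun k => div_nonneg (ha k) (pow_nonneg hr0.le k)
  have hS : 0 ≤ S := Finset.sum_nonneg fun k _ => hS_terms k
  have hE : 0 ≤ eta0 / (r - q) := div_nonneg heta0 (sub_pos.mpr hqr).le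
  have hc : 0 ≤ S + eta0 / (r - q) := add_nonneg hS hE
  have hstep : q * (S + eta0 / (r - q)) + eta0 ≤ (S + eta0 / (r - q)) * r := by
    have h1 : eta0 / (r - q) * (r - q) = eta0 := div_mul_cancel₀ _ (sub_pos.mpr hqr).ne'
    nlinarith [mul_nonneg hS (sub_pos.mpr hqr).le]
  have hinit : ∀ n ≤ N, a n ≤ (S + eta0 / (r - q)) * r ^ n := by
    intro n hn
    rw [← div_le_iff₀ (pow_pos hr0 n)]
    have : a n / r ^ n ≤ S :=
      Finset.single_le_sum (f := fun k => a k / r ^ k) (fun k _ => hS_terms k)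
        (Finset.mem_range.mpr (Nat.lt_succ_of_le hn))
    linarith
  refine ⟨S + eta0 / (r - q), r, hc, hr0.le, hr1, fun n => ?_⟩
  rcases le_total n N with hn | hn
  · exact hinit n hn
  induction n, hn using Nat.le_induction with
  | base => exact hinit N le_rfl
  | succ n hn ih =>
    calc a (n + 1) ≤ (vth + varpi n) * a n + eta0 * etab ^ n := hrec n
      _ ≤ q * ((S + eta0 / (r - q)) * r ^ n) + eta0 * r ^ n := by
        have h := hN n hn
        have hle : vth + varpi n ≤ q := by linarith
        have hpow : etab ^ n ≤ r ^ n := pow_le_pow_left₀ hetab0.le hetar.le n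
        exact add_le_add (mul_le_mul hle ih (ha n) (hvth0.trans hq).le)
          (mul_le_mul_of_nonneg_left hpow heta0)
      _ = (q * (S + eta0 / (r - q)) + eta0) * r ^ n := by ring
      _ ≤ ((S + eta0 / (r - q)) * r) * r ^ n :=
        mul_le_mul_of_nonneg_right hstep (pow_nonneg hr0.le n)
      _ = (S + eta0 / (r - q)) * r ^ (n + 1) := by ring
end
end

section
/- Under the stated contractive perturbed iteration hypotheses, the sequence (z_n) defined by z_{n+1} = Q_n^{γ_n} z_n converges linearly to z*: there exist c ∈ [0,∞) and r ∈ [0,1) such that ‖z_n − z*‖ ≤ c·rⁿ for all n ∈ ℕ. -/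
open Filter Topology
open scoped RealInnerProductSpace Pointwise

noncomputable section


/-- A nonnegative real sequence with `a (n + 1) ≤ (s + w n) * a n + b * t ^ n`, where `s, t < 1` and
`w n → 0`, decays geometrically. -/
theorem exists_le_geometric_of_perturbed_contraction {a w : ℕ → ℝ} {s t b : ℝ}
    (ha : ∀ n, 0 ≤ a n) (hw : Tendsto w atTop (𝓝 0)) (hs : s < 1)
    (ht0 : 0 ≤ t) (ht1 : t < 1) (hb : 0 ≤ b)
    (hstep : ∀ n, a (n + 1) ≤ (s + w n) * a n + b * t ^ n) :
    ∃ c r : ℝ, 0 ≤ c ∧ 0 ≤ r ∧ r < 1 ∧ ∀ n, a n ≤ c * r ^ n := by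
  obtain ⟨q, hq, hq1⟩ := exists_between (max_lt hs ht1)
  obtain ⟨r, hqr, hr1⟩ := exists_between hq1
  obtain ⟨hsq, htq⟩ := max_lt_iff.mp hq
  have hq0 : 0 < q := ht0.trans_lt htq
  have hr0 : 0 < r := hq0.trans hqr
  obtain ⟨N, hN⟩ := eventually_atTop.mp (hw.eventually_lt_const (sub_pos.mpr hsq))
  have hterm : ∀ k, 0 ≤ a k / r ^ k := fun k => div_nonneg (ha k) (by positivity)
  have hbr : 0 ≤ b / (r - q) := div_nonneg hb (sub_pos.mpr hqr).le
  have hsum : 0 ≤ ∑ k ∈ Finset.range (N + 1), a k / r ^ k :=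
    Finset.sum_nonneg fun k _ => hterm k
  set c := b / (r - q) + ∑ k ∈ Finset.range (N + 1), a k / r ^ k with hc
  have hcb : b ≤ c * (r - q) := by
    rw [← div_le_iff₀ (sub_pos.mpr hqr)]
    linarith
  have hinit : ∀ n ≤ N, a n ≤ c * r ^ n := fun n hn => by
    rw [← div_le_iff₀ (by positivity)]
    have := Finset.single_le_sum (f := fun k => a k / r ^ k) (fun k _ => hterm k)
      (Finset.mem_range.mpr (Nat.lt_succ_of_le hn))
    linarith
  refine ⟨c, r, by linarith, hr0.le, hr1, fun n => ?_⟩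
  rcases le_total n N with hn | hn
  · exact hinit n hn
  · induction n, hn using Nat.le_induction with
    | base => exact hinit N le_rfl
    | succ n hn ih =>
      have hwq : s + w n ≤ q := by linarith [hN n hn]
      calc a (n + 1) ≤ (s + w n) * a n + b * t ^ n := hstep n
        _ ≤ q * a n + b * r ^ n := by
          have := ha n
          have := htq.le.trans hqr.le
          gcongr
        _ ≤ q * (c * r ^ n) + c * (r - q) * r ^ n := by gcongr
        _ = c * r ^ (n + 1) := by ring

theorem statement7 {H : Type*} [NormedAddCommGroup H] [InnerProductSpace ℝ H]
    [CompleteSpace H]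
    (I : Set ℝ) (hI : I ⊆ Set.Ioi (0:ℝ)) (zs : H) (vth etab : ℝ)
    (hvth0 : 0 < vth) (hvth1 : vth < 1) (hetab0 : 0 < etab) (hetab1 : etab < 1)
    (Q : ℝ → H → H)
    (hQ : ∀ γ ∈ I, ∀ z : H, ‖Q γ z - zs‖ ^ 2 ≤ vth * ‖z - zs‖ ^ 2)
    (varpi : ℕ → ℝ) (hvarpi : ∀ n, 0 ≤ varpi n)
    (hvarpi0 : Tendsto varpi atTop (𝓝 0))
    (eta0 : ℝ) (heta0 : 0 ≤ eta0)
    (Qn : ℕ → ℝ → H → H)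
    (hQn : ∀ n, ∀ γ ∈ I, ∀ z : H,
      ‖Qn n γ z - Q γ z‖ ≤ varpi n * ‖z - zs‖ + eta0 * etab ^ n)
    (γ : ℕ → ℝ) (hγ : ∀ n, γ n ∈ I)
    (z : ℕ → H) (hz : ∀ n, z (n + 1) = Qn n (γ n) (z n)) :
    ∃ c r : ℝ, 0 ≤ c ∧ 0 ≤ r ∧ r < 1 ∧ ∀ n, ‖z n - zs‖ ≤ c * r ^ n := by
  refine exists_le_geometric_of_perturbed_contraction (a := fun n => ‖z n - zs‖)
    (s := √vth) (fun n => norm_nonneg _) hvarpi0 ?_ hetab0.le hetab1 heta0 fun n => ?_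
  · rwa [Real.sqrt_lt' one_pos, one_pow]
  · have hcontr : ‖Q (γ n) (z n) - zs‖ ≤ √vth * ‖z n - zs‖ := by
      refine (sq_le_sq₀ (norm_nonneg _) (by positivity)).mp ?_
      rw [mul_pow, Real.sq_sqrt hvth0.le]
      exact hQ _ (hγ n) _
    have htri := norm_sub_le_norm_sub_add_norm_sub (Qn n (γ n) (z n)) (Q (γ n) (z n)) zs
    have herr := hQn n _ (hγ n) (z n)
    simp only [hz n]
    linarith
end
end

section
/- Assume ρ̂ = ρ + αλ_min − ζ̃_{L*−K} ≥ 0, and let ε ∈ (0, χ/2) and γ ∈ [ε, χ − ε]. Then zer(A + C + D_K) = Fix T^γ, i.e. for every z ∈ H: 0 ∈ A z + C z + D_K z if and only if T^γ z = z. -/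
open Filter Topology
open scoped RealInnerProductSpace Pointwise

noncomputable section

variable {H G : Type*}

/-- Any step size below `chiConst` is smaller than the inverse of the Lipschitz constant. -/
lemma mul_lt_one_of_lt_chiConst {β ρ κ γ : ℝ} (hβ : 0 < β) (hγ : 0 < γ)
    (h : γ < chiConst β ρ κ) : γ * κ < 1 := by
  set s := Real.sqrt (1 + 16 * β ^ 2 * κ ^ 2) with hs
  have hs0 : 0 ≤ s := Real.sqrt_nonneg _
  have hγs : γ < 4 * β / (1 + s) := by
    refine h.trans_le ?_
    unfold chiConst
    split_ifs
    · exact le_rfl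
    · exact min_le_left _ _
  rw [lt_div_iff₀ (by positivity)] at hγs
  rcases le_or_gt κ 0 with hκ | hκ
  · exact (mul_nonpos_of_nonneg_of_nonpos hγ.le hκ).trans_lt one_pos
  · have hκs : 4 * β * κ ≤ s := Real.le_sqrt_of_sq_le (by nlinarith)
    nlinarith [mul_lt_mul_of_pos_right hγs hκ]

/-- The operator `Dop` inherits Lipschitz bounds of `x ↦ M (α L x + B (L x))`. -/
lemma IsLipBound.dop {H G : Type*} [NormedAddCommGroup H] [InnerProductSpace ℝ H]
    [NormedAddCommGroup G] [InnerProductSpace ℝ G] {α k : ℝ} {L : H →L[ℝ] G} {c : G}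
    {B : G → G} {M : G →L[ℝ] H} (h : IsLipBound k fun x : H => M (α • L x + B (L x))) :
    IsLipBound k (Dop α L c B M) := by
  intro x y
  have hxy : Dop α L c B M x - Dop α L c B M y
      = M (α • L x + B (L x)) - M (α • L y + B (L y)) := by
    simp only [Dop, map_add, map_sub, map_smul, smul_sub]
    abel
  rw [hxy]
  exact h x y

/-- If `D` has a Lipschitz bound `k` with `γ k < 1`, then `Id - γ D` is injective. -/
lemma IsLipBound.eq_of_sub_smul_add_smul_eq {H : Type*} [NormedAddCommGroup H]
    [NormedSpace ℝ H] {γ k : ℝ} {D : H → H} (hD : IsLipBound k D) (hγ : 0 ≤ γ)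
    (hγk : γ * k < 1) {x y : H} (h : x - γ • D x + γ • D y = y) : x = y := by
  have hxy : x - y = γ • (D x - D y) := by
    rw [smul_sub, sub_eq_iff_eq_add]
    nth_rewrite 2 [← h]
    abel
  have hle : ‖x - y‖ ≤ γ * k * ‖x - y‖ := by
    calc ‖x - y‖ = γ * ‖D x - D y‖ := by rw [hxy, norm_smul, Real.norm_of_nonneg hγ]
      _ ≤ γ * (k * ‖x - y‖) := mul_le_mul_of_nonneg_left (hD x y) hγ
      _ = γ * k * ‖x - y‖ := by ring
  have h0 : ‖x - y‖ = 0 := le_antisymm (by nlinarith [norm_nonneg (x - y)]) (norm_nonneg _)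
  exact sub_eq_zero.mp (norm_eq_zero.mp h0)

theorem statement8 {H G : Type*} [NormedAddCommGroup H] [InnerProductSpace ℝ H] [CompleteSpace H]
    [NormedAddCommGroup G] [InnerProductSpace ℝ G] [CompleteSpace G]
    (ρ β ζ α : ℝ) (A : H → Set H) (C : H → H) (B : G → G)
    (L : H →L[ℝ] G) (K : G →L[ℝ] H) (c : G)
    (hA : IsMaxMonotoneSV ρ A)
    (hβ : 0 < β) (hC : IsCocoercive β C)
    (hζ : 0 < ζ) (hBmono : IsMonotoneMap B) (hBlip : IsLipBound ζ B)
    (hα : 0 ≤ α)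
    (ζt : ℝ)
    (hζt : IsLipConst ζt (fun x : H => (ContinuousLinearMap.adjoint L - K) (B (L x))))
    (κ : ℝ) (hκ : IsLipConst κ (fun x : H => K (α • L x + B (L x))))
    (hρhat : 0 ≤ (ρ + α * lambdaMin L K - ζt))
    (ε γ : ℝ) (hε0 : 0 < ε) (hεχ : ε < chiConst β ρ κ / 2)
    (hγ1 : ε ≤ γ) (hγ2 : γ ≤ chiConst β ρ κ - ε)
    (J : H → H) (hJ : ∀ x y : H, J x = y ↔ x - y ∈ γ • A y)
    (S T : H → H)
    (hSdef : ∀ z, S z = J (z - γ • (C z + Dop α L c B K z)))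
    (hTdef : ∀ z, T z = S z - γ • Dop α L c B K (S z) + γ • Dop α L c B K z) :
    ∀ z : H, ((0:H) ∈ (fun u => u + C z + Dop α L c B K z) '' A z) ↔ T z = z := by
  have hγ : 0 < γ := hε0.trans_le hγ1
  have hγκ : γ * κ < 1 := mul_lt_one_of_lt_chiConst hβ hγ (by linarith)
  have hD : IsLipBound κ (Dop α L c B K) := hκ.1.dop
  intro z
  have hzS : ((0:H) ∈ (fun u => u + C z + Dop α L c B K z) '' A z) ↔ S z = z := by
    rw [hSdef, hJ, sub_sub_cancel_left, ← smul_neg, Set.smul_mem_smul_set_iff₀ hγ.ne']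
    constructor
    · rintro ⟨u, hu, h⟩
      rwa [← eq_neg_of_add_eq_zero_left ((add_assoc _ _ _).symm.trans h)]
    · exact fun h => ⟨_, h, by simp only; abel⟩
  rw [hzS, hTdef]
  constructor
  · intro h
    rw [h, sub_add_cancel]
  · exact fun h => hD.eq_of_sub_smul_add_smul_eq hγ.le hγκ h
end
end

section
/- Assume ρ̂ = ρ + αλ_min − ζ̃_{L*−K} ≥ 0, and let ε ∈ (0, χ/2) and γ ∈ [ε, χ − ε]. Then for every z ∈ H and every z* ∈ Fix T^γ, ‖T^γ z − z*‖² ≤ ‖z − z*‖² − κ_K²ε²‖z − S^γ z‖² − (2βε²/χ)‖Cz − Cz*‖². -/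
open Filter Topology
open scoped RealInnerProductSpace Pointwise

noncomputable section

variable {H G : Type*}

theorem IsLipConst.nonneg {E F : Type*} [NormedAddCommGroup E] [NormedAddCommGroup F]
    {k : ℝ} {f : E → F} (h : IsLipConst k f) : 0 ≤ k := by
  by_contra! hk
  have hsub : ∀ x y : E, x = y := by
    intro x y
    by_contra hxy
    have hpos : 0 < ‖x - y‖ := norm_pos_iff.2 (sub_ne_zero.2 hxy)
    have hlip := h.1 x y
    have hn := norm_nonneg (f x - f y)
    nlinarith
  have hle := h.2 (k - 1) fun x y => by rw [hsub x y]; simp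
  linarith

theorem chiConst_le (β ρ κ : ℝ) :
    chiConst β ρ κ ≤ 4 * β / (1 + Real.sqrt (1 + 16 * β ^ 2 * κ ^ 2)) := by
  unfold chiConst
  split_ifs
  · exact le_rfl
  · exact min_le_left _ _

theorem sq_mul_sq_chiConst_add_le {β ρ κ : ℝ} (hβ : 0 < β) (hχ : 0 < chiConst β ρ κ) :
    κ ^ 2 * chiConst β ρ κ ^ 2 + chiConst β ρ κ / (2 * β) ≤ 1 := by
  have hle := chiConst_le β ρ κ
  set χ := chiConst β ρ κ
  set s := Real.sqrt (1 + 16 * β ^ 2 * κ ^ 2)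
  have hs : s ^ 2 = 1 + 16 * β ^ 2 * κ ^ 2 := Real.sq_sqrt (by positivity)
  have hs0 : 0 ≤ s := Real.sqrt_nonneg _
  calc κ ^ 2 * χ ^ 2 + χ / (2 * β)
      ≤ κ ^ 2 * (4 * β / (1 + s)) ^ 2 + (4 * β / (1 + s)) / (2 * β) := by gcongr
    _ = 1 := by
      field_simp
      linear_combination -2 * hs

theorem isLipBound_Dop {H G : Type*} [NormedAddCommGroup H] [InnerProductSpace ℝ H]
    [NormedAddCommGroup G] [InnerProductSpace ℝ G]
    {α κ : ℝ} {L : H →L[ℝ] G} (c : G) {B : G → G} {M : G →L[ℝ] H}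
    (hκ : IsLipBound κ (fun x : H => M (α • L x + B (L x)))) :
    IsLipBound κ (Dop α L c B M) := by
  intro x y
  have heq : Dop α L c B M x - Dop α L c B M y
      = M (α • L x + B (L x)) - M (α • L y + B (L y)) := by
    rw [Dop_sub]
    simp only [map_sub, map_add, map_smul, smul_sub]
    abel
  rw [heq]
  exact hκ x y

theorem le_inner_sub_Dop_sub {H G : Type*} [NormedAddCommGroup H] [InnerProductSpace ℝ H]
    [CompleteSpace H] [NormedAddCommGroup G] [InnerProductSpace ℝ G] [CompleteSpace G]
    {α ζt : ℝ} (hα : 0 ≤ α) {L : H →L[ℝ] G} (c : G) {B : G → G} {K : G →L[ℝ] H}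
    (hB : IsMonotoneMap B)
    (hζt : IsLipBound ζt (fun x : H => (ContinuousLinearMap.adjoint L - K) (B (L x)))) (x y : H) :
    (α * lambdaMin L K - ζt) * ‖x - y‖ ^ 2 ≤ ⟪x - y, Dop α L c B K x - Dop α L c B K y⟫ := by
  have h1 := mul_le_mul_of_nonneg_left (lambdaMin_mul_norm_sq_le L K (x - y)) hα
  have h2 := hB (L x) (L y)
  have h3 := (real_inner_le_norm (x - y) _).trans
    (mul_le_mul_of_nonneg_left (hζt x y) (norm_nonneg (x - y)))
  simp only [← map_sub, _root_.sub_apply, inner_sub_right,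
    ContinuousLinearMap.adjoint_inner_right] at h2 h3
  rw [Dop_sub, inner_add_right, real_inner_smul_right]
  simp only [map_sub, inner_sub_right, inner_sub_left] at h1 h2 h3 ⊢
  nlinarith

theorem statement9 {H G : Type*} [NormedAddCommGroup H] [InnerProductSpace ℝ H] [CompleteSpace H]
    [NormedAddCommGroup G] [InnerProductSpace ℝ G] [CompleteSpace G]
    (ρ β ζ α : ℝ) (A : H → Set H) (C : H → H) (B : G → G)
    (L : H →L[ℝ] G) (K : G →L[ℝ] H) (c : G)
    (hA : IsMaxMonotoneSV ρ A)
    (hβ : 0 < β) (hC : IsCocoercive β C)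
    (hζ : 0 < ζ) (hBmono : IsMonotoneMap B) (hBlip : IsLipBound ζ B)
    (hα : 0 ≤ α)
    (ζt : ℝ)
    (hζt : IsLipConst ζt (fun x : H => (ContinuousLinearMap.adjoint L - K) (B (L x))))
    (κ : ℝ) (hκ : IsLipConst κ (fun x : H => K (α • L x + B (L x))))
    (hρhat : 0 ≤ (ρ + α * lambdaMin L K - ζt))
    (ε γ : ℝ) (hε0 : 0 < ε) (hεχ : ε < chiConst β ρ κ / 2)
    (hγ1 : ε ≤ γ) (hγ2 : γ ≤ chiConst β ρ κ - ε)
    (J : H → H) (hJ : ∀ x y : H, J x = y ↔ x - y ∈ γ • A y)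
    (S T : H → H)
    (hSdef : ∀ z, S z = J (z - γ • (C z + Dop α L c B K z)))
    (hTdef : ∀ z, T z = S z - γ • Dop α L c B K (S z) + γ • Dop α L c B K z) :
    ∀ z zs : H, T zs = zs →
      ‖T z - zs‖ ^ 2 ≤ ‖z - zs‖ ^ 2 - κ ^ 2 * ε ^ 2 * ‖z - S z‖ ^ 2 -
        (2 * β * ε ^ 2 / chiConst β ρ κ) * ‖C z - C zs‖ ^ 2 := by
  intro z zs hfix
  have hχ : 0 < chiConst β ρ κ := by linarith
  have hquad := sq_mul_sq_chiConst_add_le hβ hχ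
  set χ := chiConst β ρ κ
  have hγ : 0 < γ := hε0.trans_le hγ1
  have hκ0 : 0 ≤ κ := hκ.nonneg
  have hDlip : IsLipBound κ (Dop α L c B K) := isLipBound_Dop c hκ.1
  have hDmono := le_inner_sub_Dop_sub hα c hBmono hζt.1
  set D := Dop α L c B K
  have hγκ : γ * κ < 1 := by
    have hp : 0 < χ / (2 * β) := by positivity
    have h1 : γ * κ ≤ χ * κ := by gcongr; linarith
    have h2 : 0 ≤ χ * κ := by positivity
    nlinarith
  have hSzs : S zs = zs := by
    have heq : S zs - zs = γ • (D (S zs) - D zs) := by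
      have h := hTdef zs
      rw [hfix] at h
      nth_rewrite 2 [h]
      rw [smul_sub]
      abel
    by_contra hne
    have hpos : 0 < ‖S zs - zs‖ := norm_pos_iff.2 (sub_ne_zero.2 hne)
    have h1 : ‖S zs - zs‖ ≤ γ * (κ * ‖S zs - zs‖) := by
      conv_lhs => rw [heq, norm_smul, Real.norm_of_nonneg hγ.le]
      exact mul_le_mul_of_nonneg_left (hDlip _ _) hγ.le
    nlinarith
  obtain ⟨u, hu, hu'⟩ := (hJ _ _).1 (hSdef z).symm
  obtain ⟨v, hv, hv'⟩ := (hJ _ _).1 ((hSdef zs).symm.trans hSzs)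
  simp only at hu' hv'
  have hAmono := hA.1 _ _ _ _ hu hv
  have hDmono' := hDmono (S z) zs
  have hD := hDlip z (S z)
  have hcoco := hC z zs
  have hcs := real_inner_le_norm (z - S z) (C z - C zs)
  have hkey : 0 ≤ ⟪S z - zs, (z - S z) - γ • (D z - D (S z)) - γ • (C z - C zs)⟫ := by
    have heq : (z - S z) - γ • (D z - D (S z)) - γ • (C z - C zs)
        = γ • ((u - v) + (D (S z) - D zs)) := by
      rw [smul_add, smul_sub γ u v, hu', hv']
      simp only [smul_sub, smul_add]
      abel
    rw [heq, real_inner_smul_right, inner_add_right]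
    refine mul_nonneg hγ.le ?_
    nlinarith [mul_nonneg hρhat (sq_nonneg ‖S z - zs‖)]
  have hT : T z - zs = (S z - zs) + γ • (D z - D (S z)) := by
    rw [hTdef, smul_sub]; abel
  have hz : z - zs = (S z - zs) + (z - S z) := by abel
  have hD2 : ‖D z - D (S z)‖ ^ 2 ≤ κ ^ 2 * ‖z - S z‖ ^ 2 := by
    rw [← mul_pow]; gcongr
  have hmain : ‖T z - zs‖ ^ 2 ≤ ‖z - zs‖ ^ 2 - (1 - γ ^ 2 * κ ^ 2) * ‖z - S z‖ ^ 2
      - 2 * γ * β * ‖C z - C zs‖ ^ 2 + 2 * γ * (‖z - S z‖ * ‖C z - C zs‖) := by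
    rw [hz, inner_add_left] at hcoco
    rw [hT, hz, norm_add_sq_real, norm_add_sq_real, norm_smul, mul_pow, Real.norm_eq_abs, sq_abs,
      real_inner_smul_right]
    simp only [inner_sub_right _ (_ - _) (γ • _), real_inner_smul_right] at hkey
    nlinarith [mul_le_mul_of_nonneg_left hD2 (sq_nonneg γ), mul_le_mul_of_nonneg_left hcoco hγ.le,
      mul_le_mul_of_nonneg_left hcs hγ.le]
  have hyoung : 2 * γ * (‖z - S z‖ * ‖C z - C zs‖)
      ≤ χ / (2 * β) * ‖z - S z‖ ^ 2 + 2 * β * γ ^ 2 / χ * ‖C z - C zs‖ ^ 2 := by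
    have hsq : 0 ≤ (χ * ‖z - S z‖ - 2 * β * γ * ‖C z - C zs‖) ^ 2 / (2 * β * χ) := by positivity
    have heq : (χ * ‖z - S z‖ - 2 * β * γ * ‖C z - C zs‖) ^ 2 / (2 * β * χ)
        = χ / (2 * β) * ‖z - S z‖ ^ 2 + 2 * β * γ ^ 2 / χ * ‖C z - C zs‖ ^ 2
          - 2 * γ * (‖z - S z‖ * ‖C z - C zs‖) := by
      field_simp
      ring
    linarith
  have hcoefC : 2 * β * ε ^ 2 / χ ≤ 2 * γ * β - 2 * β * γ ^ 2 / χ := by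
    have heq : 2 * γ * β - 2 * β * γ ^ 2 / χ = 2 * β * (γ * (χ - γ)) / χ := by
      field_simp
    rw [heq]
    have : ε ^ 2 ≤ γ * (χ - γ) := by nlinarith
    gcongr
  have hcoefS : κ ^ 2 * ε ^ 2 ≤ 1 - γ ^ 2 * κ ^ 2 - χ / (2 * β) := by
    have : ε ^ 2 ≤ χ ^ 2 - γ ^ 2 := by nlinarith
    linarith [mul_le_mul_of_nonneg_left this (sq_nonneg κ)]
  have h1 := mul_le_mul_of_nonneg_right hcoefC (sq_nonneg ‖C z - C zs‖)
  have h2 := mul_le_mul_of_nonneg_right hcoefS (sq_nonneg ‖z - S z‖)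
  linarith
end
end
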